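/- Fix α > 1 and ρ ∈ (0,1); there exist constants C₁ = C₁(α,ρ) and C₂ = C₂(α,ρ) such that the following holds. Let E ⊂ ℝ² be Ahlfors regular with constant A, μ = ℋ¹|_E, x ∈ ℝ², let J ⊂ 𝕋 be an interval, and let 0 ≤ l ≤ j be integers. Then: (1) #Bad(x,J,l,j) ≤ C₁·A·ℋ¹(J)⁻¹·∫_{ρ^j}^{ρ^l} μ(X(x,αJ,ρr,r))·r⁻² dr + C₁. (2) If in addition there exist y ∈ ℝ² with d_J(x,y) ≤ α·ρ^j and θ ∈ αJ with μ_θ^⊥(y) ≤ M, then ∫_{ρ^j}^{ρ^l} μ(X(x,J,ρr,r))·r⁻² dr ≤ C₂·M·ℋ¹(J)·#Bad(x,J,l,j). -/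

import Mathlib

open MeasureTheory Metric Set
open scoped ENNReal NNReal

noncomputable section

abbrev R2 := EuclideanSpace ℝ (Fin 2)

/-- The unit vector in direction `2πθ`. -/
def dir (θ : ℝ) : R2 :=
  (EuclideanSpace.equiv (Fin 2) ℝ).symm ![Real.cos (2 * Real.pi * θ), Real.sin (2 * Real.pi * θ)]

/-- Orthogonal projection `π_θ`. -/
def proj (θ : ℝ) (x : R2) : ℝ :=
  x 0 * Real.cos (2 * Real.pi * θ) + x 1 * Real.sin (2 * Real.pi * θ)

/-- `π_θ^⊥ = π_{θ+1/4}`. -/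
def projPerp (θ : ℝ) (x : R2) : ℝ := proj (θ + 1/4) x

/-- Favard length. -/
def Fav (E : Set R2) : ℝ≥0∞ := ∫⁻ θ in Set.Icc (0:ℝ) 1, μH[1] (proj θ '' E)

/-- Ahlfors regularity with constant `A`. -/
def AhlforsRegular (A : ℝ) (E : Set R2) : Prop :=
  IsClosed E ∧ ∀ x ∈ E, ∀ r : ℝ, 0 < r → ENNReal.ofReal r < EMetric.diam E →
    ENNReal.ofReal (A⁻¹ * r) ≤ μH[1] (E ∩ ball x r) ∧
      μH[1] (E ∩ ball x r) ≤ ENNReal.ofReal (A * r)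

/-- A Lipschitz graph with constant `L`: rotated graph of an `L`-Lipschitz function. -/
def IsLipschitzGraph (L : ℝ) (Γ : Set R2) : Prop :=
  ∃ (R : R2 ≃ₗᵢ[ℝ] R2) (f : ℝ → ℝ), LipschitzWith (Real.toNNReal L) f ∧
    Γ = R '' {x : R2 | x 1 = f (x 0)}

/-- The (untruncated) cone `X(x,G)`. -/
def cone (x : R2) (G : Set ℝ) : Set R2 := ⋃ θ ∈ G, {y | ∃ t : ℝ, y = x + t • dir θ}

/-- The truncated cone `X(x,G,r)`. -/
def coneT (x : R2) (G : Set ℝ) (r : ℝ) : Set R2 := cone x G ∩ ball x r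

/-- The doubly truncated cone `X(x,G,r,R)`. -/
def coneA (x : R2) (G : Set ℝ) (r R : ℝ) : Set R2 := coneT x G R \ ball x r

/-- Hardy–Littlewood maximal function of a measure on `ℝ`. -/
def maximalFn (ν : Measure ℝ) (t : ℝ) : ℝ≥0∞ :=
  ⨆ (r : ℝ) (_ : 0 < r), ν (Set.Ioo (t - r) (t + r)) / ENNReal.ofReal (2 * r)

/-- `μ_θ(x) = M(π_θ μ)(π_θ x)`. -/
def projMax (μ : Measure R2) (θ : ℝ) (x : R2) : ℝ≥0∞ :=
  maximalFn (μ.map (proj θ)) (proj θ x)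

/-- `μ_θ^⊥(x) = M(π_θ^⊥ μ)(π_θ^⊥ x)`. -/
def projMaxPerp (μ : Measure R2) (θ : ℝ) (x : R2) : ℝ≥0∞ :=
  maximalFn (μ.map (projPerp θ)) (projPerp θ x)

/-- The interval with center `c` and length `ℓ`. -/
def itv (c ℓ : ℝ) : Set ℝ := Set.Icc (c - ℓ/2) (c + ℓ/2)

/-- The metric `d_I` associated to the interval with center `c` and length `ℓ`. -/
def dmet (c ℓ : ℝ) (x y : R2) : ℝ :=
  Real.sqrt ((ℓ^2)⁻¹ * (projPerp c x - projPerp c y)^2 + (proj c x - proj c y)^2)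

/-- The open `d_I`-ball `B_I(x,r)`. -/
def bmet (c ℓ : ℝ) (x : R2) (r : ℝ) : Set R2 := {y | dmet c ℓ x y < r}

/-- Triadic intervals of `[0,1)`. -/
def IsTriadic (I : Set ℝ) : Prop :=
  ∃ (j k : ℕ), k < 3^j ∧ I = Set.Ico ((k : ℝ)/3^j) ((k+1 : ℝ)/3^j)

/-- 1-dimensional Hausdorff content. -/
def hContent {X : Type*} [EMetricSpace X] (s : Set X) : ℝ≥0∞ :=
  ⨅ (t : ℕ → Set X) (_ : s ⊆ ⋃ n, t n), ∑' n, EMetric.diam (t n)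

/-- `E` is a finite union of parallel segments. -/
def FinUnionParallelSegments (E : Set R2) : Prop :=
  ∃ (n : ℕ) (d : R2) (p q : Fin n → R2), d ≠ 0 ∧
    (∀ i, ∃ t : ℝ, q i - p i = t • d) ∧ E = ⋃ i, segment ℝ (p i) (q i)


/-- The number of bad scales in `[l,j]` for the point `x`, the interval with center `c`
and length `ℓ`, and the set `E`, at scale ratio `ρ`. -/
def badCard (ρ : ℝ) (E : Set R2) (x : R2) (c ℓ : ℝ) (l j : ℕ) : ℕ :=
  Set.ncard {k : ℕ | l ≤ k ∧ k ≤ j ∧ (coneA x (itv c ℓ) (ρ^(k+1)) (ρ^k) ∩ E).Nonempty}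

@[simp] lemma dir_zero_coord (θ : ℝ) : dir θ 0 = Real.cos (2 * Real.pi * θ) := by simp [dir]

@[simp] lemma dir_one_coord (θ : ℝ) : dir θ 1 = Real.sin (2 * Real.pi * θ) := by simp [dir]

lemma norm_dir (θ : ℝ) : ‖dir θ‖ = 1 := by
  rw [EuclideanSpace.norm_eq, Fin.sum_univ_two]
  simp

lemma dist_add_smul_dir (x : R2) (t θ : ℝ) : dist (x + t • dir θ) x = |t| := by
  rw [dist_eq_norm, add_sub_cancel_left, norm_smul, norm_dir, mul_one, Real.norm_eq_abs]

lemma projPerp_eq (θ : ℝ) (x : R2) :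
    projPerp θ x = x 1 * Real.cos (2 * Real.pi * θ) - x 0 * Real.sin (2 * Real.pi * θ) := by
  have h : 2 * Real.pi * (θ + 1 / 4) = 2 * Real.pi * θ + Real.pi / 2 := by ring
  rw [projPerp, proj, h, Real.cos_add_pi_div_two, Real.sin_add_pi_div_two]
  ring

lemma continuous_projPerp (θ : ℝ) : Continuous (projPerp θ) := by
  unfold projPerp proj
  fun_prop

lemma proj_sq_add_projPerp_sq (θ : ℝ) (x : R2) : proj θ x ^ 2 + projPerp θ x ^ 2 = ‖x‖ ^ 2 := by
  rw [EuclideanSpace.norm_sq_eq, Fin.sum_univ_two, projPerp_eq, proj]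
  simp only [Real.norm_eq_abs, sq_abs]
  linear_combination (x 0 ^ 2 + x 1 ^ 2) * Real.sin_sq_add_cos_sq (2 * Real.pi * θ)

/-- A ball centred at a point of a line through `x`, small compared to its distance to `x`, lies
in a cone of small aperture around that line. -/
lemma exists_eq_add_smul_dir {x z : R2} {t φ δ : ℝ} (ht : t ≠ 0) (hδ : δ ≤ 1 / 2)
    (hz : dist z (x + t • dir φ) ≤ δ * |t|) :
    ∃ ψ s : ℝ, |ψ - φ| ≤ δ ∧ z = x + s • dir ψ := by
  set w : R2 := z - (x + t • dir φ) with hw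
  have hwn : ‖w‖ ≤ δ * |t| := by rw [hw, ← dist_eq_norm]; exact hz
  have htp : 0 < |t| := abs_pos.2 ht
  have hδ0 : 0 ≤ δ := by
    by_contra h
    have := norm_nonneg w
    nlinarith
  have hsq := proj_sq_add_projPerp_sq φ w
  have h1 : |proj φ w| ≤ δ * |t| :=
    (abs_le_of_sq_le_sq (by nlinarith [sq_nonneg (projPerp φ w)]) (norm_nonneg w)).trans hwn
  have h2 : |projPerp φ w| ≤ δ * |t| :=
    (abs_le_of_sq_le_sq (by nlinarith [sq_nonneg (proj φ w)]) (norm_nonneg w)).trans hwn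
  set a := t + proj φ w with ha
  have hab : |t| / 2 ≤ |a| := by
    have := abs_sub_abs_le_abs_sub t (-proj φ w)
    rw [abs_neg, sub_neg_eq_add] at this
    nlinarith
  have hap : 0 < |a| := by linarith
  have ha0 : a ≠ 0 := abs_pos.1 hap
  set u := projPerp φ w / a with hu
  have hu' : |u| ≤ 2 * δ := by
    rw [hu, abs_div, div_le_iff₀ hap]
    nlinarith
  have hcos := Real.cos_arctan_pos u
  have hsin : Real.sin (Real.arctan u) = u * Real.cos (Real.arctan u) := by
    rw [← Real.tan_mul_cos hcos.ne', Real.tan_arctan]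
  have harc : |Real.arctan u| ≤ |u| := by
    have key : ∀ v : ℝ, 0 ≤ v → Real.arctan v ≤ v := fun v hv => by
      have h0 := Real.arctan_nonneg.2 hv
      have := Real.le_tan h0 (Real.arctan_lt_pi_div_two v)
      rwa [Real.tan_arctan] at this
    rcases le_total 0 u with h | h
    · rw [abs_of_nonneg h, abs_of_nonneg (Real.arctan_nonneg.2 h)]
      exact key u h
    · have := key (-u) (by linarith)
      have h0 := Real.arctan_nonneg.2 (show 0 ≤ -u by linarith)
      rw [Real.arctan_neg] at this h0
      rw [abs_of_nonpos h, abs_of_nonpos (by linarith)]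
      exact this
  refine ⟨φ + Real.arctan u / (2 * Real.pi), a / Real.cos (Real.arctan u), ?_, ?_⟩
  · rw [add_sub_cancel_left, abs_div, abs_of_pos Real.two_pi_pos, div_le_iff₀ Real.two_pi_pos]
    nlinarith [Real.pi_gt_three]
  · have hang : 2 * Real.pi * (φ + Real.arctan u / (2 * Real.pi))
        = 2 * Real.pi * φ + Real.arctan u := by
      field_simp
    have hau : a * u = projPerp φ w := by rw [hu]; field_simp
    have hz' : z = x + t • dir φ + w := by rw [hw]; abel
    have hsc := Real.sin_sq_add_cos_sq (2 * Real.pi * φ)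
    have e0 : a / Real.cos (Real.arctan u)
        * Real.cos (2 * Real.pi * (φ + Real.arctan u / (2 * Real.pi)))
        = a * Real.cos (2 * Real.pi * φ) - a * u * Real.sin (2 * Real.pi * φ) := by
      rw [hang, Real.cos_add, hsin]
      field_simp
    have e1 : a / Real.cos (Real.arctan u)
        * Real.sin (2 * Real.pi * (φ + Real.arctan u / (2 * Real.pi)))
        = a * Real.sin (2 * Real.pi * φ) + a * u * Real.cos (2 * Real.pi * φ) := by
      rw [hang, Real.sin_add, hsin]
      field_simp
    rw [hau, ha, projPerp_eq, proj] at e0 e1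
    rw [hz']
    ext i
    fin_cases i
    · simp only [PiLp.add_apply, PiLp.smul_apply, smul_eq_mul, Fin.zero_eta, dir_zero_coord]
      rw [ha, proj, e0]
      linear_combination (-(w 0)) * hsc
    · simp only [PiLp.add_apply, PiLp.smul_apply, smul_eq_mul, Fin.mk_one, dir_one_coord]
      rw [ha, proj, e1]
      linear_combination (-(w 1)) * hsc

lemma abs_projPerp_add_smul_dir_sub_le (x : R2) (t φ θ : ℝ) :
    |projPerp θ (x + t • dir φ) - projPerp θ x| ≤ |t| * (2 * Real.pi * |φ - θ|) := by
  have h : projPerp θ (x + t • dir φ) - projPerp θ x = t * Real.sin (2 * Real.pi * (φ - θ)) := by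
    rw [projPerp_eq, projPerp_eq, mul_sub, Real.sin_sub]
    simp only [PiLp.add_apply, PiLp.smul_apply, smul_eq_mul, dir_zero_coord, dir_one_coord]
    ring
  rw [h, abs_mul]
  refine mul_le_mul_of_nonneg_left (Real.abs_sin_le_abs.trans ?_) (abs_nonneg t)
  rw [abs_mul, abs_of_pos Real.two_pi_pos]

lemma abs_projPerp_sub_le_of_dmet_le {c ℓ d θ : ℝ} (hℓ : 0 < ℓ) {x y : R2}
    (hd : dmet c ℓ x y ≤ d) :
    |projPerp θ x - projPerp θ y| ≤ d * ℓ + d * (2 * Real.pi * |θ - c|) := by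
  have hd0 : 0 ≤ d := (Real.sqrt_nonneg _).trans hd
  set p := projPerp c x - projPerp c y with hp
  set q := proj c x - proj c y with hq
  have hs : (ℓ ^ 2)⁻¹ * p ^ 2 + q ^ 2 ≤ d ^ 2 := (Real.sqrt_le_left hd0).1 hd
  have hq' : |q| ≤ d := abs_le_of_sq_le_sq
    (by nlinarith [show 0 ≤ (ℓ ^ 2)⁻¹ * p ^ 2 by positivity]) hd0
  have hp' : |p| ≤ d * ℓ := by
    refine abs_le_of_sq_le_sq ?_ (by positivity)
    have h1 : (ℓ ^ 2)⁻¹ * p ^ 2 ≤ d ^ 2 := by nlinarith [sq_nonneg q]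
    rw [inv_mul_le_iff₀ (by positivity)] at h1
    linarith
  have h : projPerp θ x - projPerp θ y
      = p * Real.cos (2 * Real.pi * (θ - c)) - q * Real.sin (2 * Real.pi * (θ - c)) := by
    rw [hp, hq, mul_sub, Real.sin_sub, Real.cos_sub]
    simp only [projPerp_eq, proj]
    linear_combination (-(x 1 - y 1) * Real.cos (2 * Real.pi * θ)
      + (x 0 - y 0) * Real.sin (2 * Real.pi * θ)) * Real.sin_sq_add_cos_sq (2 * Real.pi * c)
  rw [h]
  refine (abs_sub _ _).trans (add_le_add ?_ ?_)
  · rw [abs_mul]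
    exact (mul_le_of_le_one_right (abs_nonneg p) (Real.abs_cos_le_one _)).trans hp'
  · rw [abs_mul]
    refine mul_le_mul hq' (Real.abs_sin_le_abs.trans ?_) (abs_nonneg _) hd0
    rw [abs_mul, abs_of_pos Real.two_pi_pos]

lemma measure_preimage_Ioo_le_of_maximalFn_le {X : Type*} [MeasurableSpace X] {μ : Measure X}
    {f : X → ℝ} (hf : Measurable f) {t R M : ℝ} (hR : 0 < R)
    (h : maximalFn (μ.map f) t ≤ ENNReal.ofReal M) :
    μ (f ⁻¹' Ioo (t - R) (t + R)) ≤ ENNReal.ofReal (2 * R * M) := by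
  rw [← Measure.map_apply hf measurableSet_Ioo, ENNReal.ofReal_mul (by positivity), mul_comm]
  have h0 : ENNReal.ofReal (2 * R) ≠ 0 := by simpa using hR
  refine (ENNReal.div_le_iff h0 ENNReal.ofReal_ne_top).1 (le_trans ?_ h)
  exact le_iSup₂ (f := fun (r : ℝ) (_ : 0 < r) =>
    μ.map f (Ioo (t - r) (t + r)) / ENNReal.ofReal (2 * r)) R hR

lemma setLIntegral_Ioc_eq_sum_pow {ρ : ℝ} (hρ0 : 0 < ρ) (hρ1 : ρ < 1) (f : ℝ → ℝ≥0∞)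
    {l j : ℕ} (hlj : l ≤ j) :
    ∫⁻ r in Ioc (ρ ^ j) (ρ ^ l), f r
      = ∑ k ∈ Finset.Ico l j, ∫⁻ r in Ioc (ρ ^ (k + 1)) (ρ ^ k), f r := by
  induction j, hlj using Nat.le_induction with
  | base => simp
  | succ n hn ih =>
    have h1 : ρ ^ (n + 1) ≤ ρ ^ n := pow_le_pow_of_le_one hρ0.le hρ1.le n.le_succ
    have h2 : ρ ^ n ≤ ρ ^ l := pow_le_pow_of_le_one hρ0.le hρ1.le hn
    rw [Finset.sum_Ico_succ_top hn, ← ih, ← Ioc_union_Ioc_eq_Ioc h1 h2,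
      lintegral_union measurableSet_Ioc, add_comm]
    exact Set.disjoint_left.2 fun r hr hr' => not_lt.2 hr.2 hr'.1

/-- A finite set of natural numbers of diameter at most one has at most two elements. -/
lemma Finset.card_le_two_of_le_add_one (T : Finset ℕ)
    (h : ∀ k ∈ T, ∀ k' ∈ T, k' ≤ k + 1) : T.card ≤ 2 := by
  rcases T.eq_empty_or_nonempty with rfl | hT
  · simp
  · refine (Finset.card_le_card (t := {T.min' hT, T.min' hT + 1}) fun k hk => ?_).trans
      Finset.card_le_two
    have h1 := h _ (T.min'_mem hT) k hk
    have h2 := T.min'_le k hk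
    simp only [Finset.mem_insert, Finset.mem_singleton]
    omega

/-- The finite set of bad scales. -/
def badScales (ρ : ℝ) (E : Set R2) (x : R2) (c ℓ : ℝ) (l j : ℕ) : Finset ℕ := by
  classical
  exact (Finset.Icc l j).filter fun k => (coneA x (itv c ℓ) (ρ ^ (k + 1)) (ρ ^ k) ∩ E).Nonempty

lemma mem_badScales {ρ : ℝ} {E : Set R2} {x : R2} {c ℓ : ℝ} {l j k : ℕ} :
    k ∈ badScales ρ E x c ℓ l j ↔
      l ≤ k ∧ k ≤ j ∧ (coneA x (itv c ℓ) (ρ ^ (k + 1)) (ρ ^ k) ∩ E).Nonempty := by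
  classical
  simp [badScales, and_assoc]

lemma badCard_eq_card_badScales (ρ : ℝ) (E : Set R2) (x : R2) (c ℓ : ℝ) (l j : ℕ) :
    badCard ρ E x c ℓ l j = (badScales ρ E x c ℓ l j).card := by
  rw [badCard, ← Set.ncard_coe_finset]
  congr 1
  ext k
  simp [mem_badScales]

lemma mem_coneA_iff {x z : R2} {G : Set ℝ} {r R : ℝ} :
    z ∈ coneA x G r R ↔
      ∃ φ ∈ G, ∃ t : ℝ, z = x + t • dir φ ∧ |t| < R ∧ r ≤ |t| := by
  simp only [coneA, coneT, cone, mem_sdiff, mem_inter_iff, mem_iUnion, mem_ofPred_eq, mem_ball,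
    not_lt, exists_prop]
  constructor
  · rintro ⟨⟨⟨φ, hφ, t, rfl⟩, h1⟩, h2⟩
    rw [dist_add_smul_dir] at h1 h2
    exact ⟨φ, hφ, t, rfl, h1, h2⟩
  · rintro ⟨φ, hφ, t, rfl, h1, h2⟩
    rw [dist_add_smul_dir]
    exact ⟨⟨⟨φ, hφ, t, rfl⟩, h1⟩, h2⟩

/-- The energy contributed by one bad scale at which the lower regularity bound is available. -/
lemma le_setLIntegral_of_bad {α ρ η A c ℓ : ℝ} {E : Set R2} {x : R2} {k : ℕ}
    (hρ0 : 0 < ρ) (hρ1 : ρ < 1) (hη0 : 0 < η) (hη1 : η ≤ ρ * (α - 1) / 2) (hη2 : η ≤ ρ / 2)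
    (hη3 : η ≤ ρ * (1 - ρ) / 4) (hA : 1 ≤ A) (hE : AhlforsRegular A E) (hℓ0 : 0 < ℓ)
    (hℓ1 : ℓ ≤ 1)
    (hdiam : ENNReal.ofReal (η * ℓ * ρ ^ (k + 1)) < ediam E)
    (hbad : (coneA x (itv c ℓ) (ρ ^ (k + 2)) (ρ ^ (k + 1)) ∩ E).Nonempty) :
    ENNReal.ofReal (A⁻¹ * η * ℓ * (ρ ^ 2 * (1 - ρ) / 2)) ≤
      ∫⁻ r in Ioc (ρ ^ (k + 2)) (ρ ^ k),
        (μH[1].restrict E) (coneA x (itv c (α * ℓ)) (ρ * r) r) / ENNReal.ofReal (r ^ 2) := by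
  obtain ⟨p, hp, hpE⟩ := hbad
  obtain ⟨φ, hφ, t, rfl, htR, htr⟩ := mem_coneA_iff.1 hp
  set P := ρ ^ k with hP
  have hP0 : 0 < P := pow_pos hρ0 k
  have e1 : ρ ^ (k + 1) = ρ * P := by rw [hP]; ring
  have e2 : ρ ^ (k + 2) = ρ ^ 2 * P := by rw [hP]; ring
  rw [e1] at htR hdiam
  rw [e2] at htr ⊢
  have ht0 : 0 < |t| := lt_of_lt_of_le (by positivity) htr
  set ε := η * ℓ * (ρ * P) with hε
  have hε0 : 0 < ε := by positivity
  have hεη : ε ≤ η * (ρ * P) := by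
    rw [hε]
    have : 0 < η * (ρ * P) := by positivity
    nlinarith
  have hball : ∀ r ∈ Ioc (|t| + ε) ((|t| - ε) / ρ),
      E ∩ ball (x + t • dir φ) ε ⊆ coneA x (itv c (α * ℓ)) (ρ * r) r ∩ E := by
    rintro r ⟨hr1, hr2⟩ z ⟨hzE, hz⟩
    rw [mem_ball] at hz
    refine ⟨?_, hzE⟩
    rw [le_div_iff₀ hρ0] at hr2
    have hδ : dist z (x + t • dir φ) ≤ (η * ℓ / ρ) * |t| := by
      refine hz.le.trans ?_
      have : ε = (η * ℓ / ρ) * (ρ ^ 2 * P) := by rw [hε]; field_simp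
      rw [this]
      gcongr
    have hδ2 : η * ℓ / ρ ≤ 1 / 2 := by
      rw [div_le_iff₀ hρ0]; nlinarith
    obtain ⟨ψ, s, hψ, rfl⟩ := exists_eq_add_smul_dir (abs_pos.1 ht0) hδ2 hδ
    have hψ2 : |ψ - φ| ≤ (α - 1) * ℓ / 2 := by
      refine hψ.trans ?_
      rw [div_le_iff₀ hρ0]
      nlinarith
    have hs : |dist (x + s • dir ψ) x - dist (x + t • dir φ) x| < ε :=
      (abs_dist_sub_le _ _ _).trans_lt hz
    rw [dist_add_smul_dir, dist_add_smul_dir, abs_lt] at hs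
    refine mem_coneA_iff.2 ⟨ψ, ?_, s, rfl, by linarith, by linarith⟩
    rw [itv, mem_Icc] at hφ ⊢
    rw [abs_le] at hψ2
    constructor <;> nlinarith
  have hsub : Ioc (|t| + ε) ((|t| - ε) / ρ) ⊆ Ioc (ρ ^ 2 * P) P := by
    rintro r ⟨hr1, hr2⟩
    rw [le_div_iff₀ hρ0] at hr2
    refine ⟨by linarith, ?_⟩
    nlinarith
  have hlow : ∀ r ∈ Ioc (|t| + ε) ((|t| - ε) / ρ),
      ENNReal.ofReal (A⁻¹ * ε / P ^ 2) ≤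
        (μH[1].restrict E) (coneA x (itv c (α * ℓ)) (ρ * r) r) / ENNReal.ofReal (r ^ 2) := by
    intro r hr
    rw [ENNReal.ofReal_div_of_pos (by positivity)]
    have hrP := hsub hr
    have hr0 : 0 < r := lt_of_le_of_lt (by positivity) hrP.1
    refine ENNReal.div_le_div ?_
      (ENNReal.ofReal_le_ofReal (pow_le_pow_left₀ hr0.le hrP.2 2))
    calc ENNReal.ofReal (A⁻¹ * ε) ≤ μH[1] (E ∩ ball (x + t • dir φ) ε) :=
          (hE.2 _ hpE ε hε0 hdiam).1
      _ ≤ μH[1] (coneA x (itv c (α * ℓ)) (ρ * r) r ∩ E) := measure_mono (hball r hr)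
      _ ≤ _ := Measure.le_restrict_apply _ _
  calc ENNReal.ofReal (A⁻¹ * η * ℓ * (ρ ^ 2 * (1 - ρ) / 2))
      ≤ ENNReal.ofReal (A⁻¹ * ε / P ^ 2 * ((|t| - ε) / ρ - (|t| + ε))) := by
        apply ENNReal.ofReal_le_ofReal
        have hlen : ρ * P * (1 - ρ) / 2 ≤ (|t| - ε) / ρ - (|t| + ε) := by
          rw [le_sub_iff_add_le, le_div_iff₀ hρ0]
          have h1 : (1 - ρ) * (ρ ^ 2 * P) ≤ (1 - ρ) * |t| :=
            mul_le_mul_of_nonneg_left htr (by linarith)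
          have h2 : ε * (1 + ρ) ≤ ρ * (1 - ρ) / 4 * (ρ * P) * 2 := by
            refine mul_le_mul (hεη.trans ?_) (by linarith) (by linarith) ?_
            · gcongr
            · have : 0 < 1 - ρ := by linarith
              positivity
          nlinarith
        calc A⁻¹ * η * ℓ * (ρ ^ 2 * (1 - ρ) / 2)
            = A⁻¹ * ε / P ^ 2 * (ρ * P * (1 - ρ) / 2) := by rw [hε]; field_simp
          _ ≤ _ := by gcongr
    _ = ∫⁻ _ in Ioc (|t| + ε) ((|t| - ε) / ρ), ENNReal.ofReal (A⁻¹ * ε / P ^ 2) := by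
        rw [setLIntegral_const, Real.volume_Ioc, ENNReal.ofReal_mul (by positivity)]
    _ ≤ _ := setLIntegral_mono' measurableSet_Ioc hlow
    _ ≤ _ := lintegral_mono_set hsub

/-- Bad scales larger than a multiple of the diameter of `E` are consecutive. -/
lemma le_add_one_of_bad_of_diam_le {ρ η : ℝ} {E : Set R2} {x : R2} {G : Set ℝ} {k k' : ℕ}
    (hρ0 : 0 < ρ) (hρ1 : ρ < 1) (hη0 : 0 < η) (hη : η ≤ ρ * (1 - ρ) / 4)
    (hdiam : ediam E ≤ ENNReal.ofReal (η * ρ ^ k'))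
    (hk : (coneA x G (ρ ^ (k + 1)) (ρ ^ k) ∩ E).Nonempty)
    (hk' : (coneA x G (ρ ^ (k' + 1)) (ρ ^ k') ∩ E).Nonempty) : k' ≤ k + 1 := by
  by_contra! h
  obtain ⟨p, hp, hpE⟩ := hk
  obtain ⟨q, hq, hqE⟩ := hk'
  obtain ⟨φ, -, t, rfl, -, ht⟩ := mem_coneA_iff.1 hp
  obtain ⟨ψ, -, s, rfl, hs, -⟩ := mem_coneA_iff.1 hq
  have hd : dist (x + t • dir φ) (x + s • dir ψ) ≤ η * ρ ^ k' := by
    rw [← ENNReal.ofReal_le_ofReal_iff (by positivity), ← edist_dist]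
    exact (edist_le_ediam_of_mem hpE hqE).trans hdiam
  have hd2 := (abs_dist_sub_le (x + t • dir φ) (x + s • dir ψ) x).trans hd
  rw [dist_add_smul_dir, dist_add_smul_dir] at hd2
  have h3 := (le_abs_self _).trans hd2
  have h4 : ρ ^ k' ≤ ρ ^ (k + 2) := pow_le_pow_of_le_one hρ0.le hρ1.le h
  have h5 : ρ ^ (k + 2) = ρ * ρ ^ (k + 1) := by ring
  have h6 : 0 < ρ ^ (k + 1) := by positivity
  have h7 : ρ ^ (k + 1) ≤ (1 + η) * (ρ * ρ ^ (k + 1)) := by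
    rw [← h5]
    nlinarith
  have h8 : 1 ≤ (1 + η) * ρ := by
    by_contra! hlt
    nlinarith
  nlinarith

lemma badCard_le_energy {α ρ η A c ℓ : ℝ} {E : Set R2} {x : R2} {l j : ℕ}
    (hρ0 : 0 < ρ) (hρ1 : ρ < 1) (hη0 : 0 < η) (hη1 : η ≤ ρ * (α - 1) / 2) (hη2 : η ≤ ρ / 2)
    (hη3 : η ≤ ρ * (1 - ρ) / 4) (hA : 1 ≤ A) (hE : AhlforsRegular A E) (hℓ0 : 0 < ℓ)
    (hℓ1 : ℓ ≤ 1) (hlj : l ≤ j) :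
    (badCard ρ E x c ℓ l j : ℝ≥0∞) ≤
      ENNReal.ofReal (4 / (η * ρ ^ 2 * (1 - ρ)) * A * ℓ⁻¹) *
        (∫⁻ r in Ioc (ρ ^ j) (ρ ^ l),
          (μH[1].restrict E) (coneA x (itv c (α * ℓ)) (ρ * r) r) / ENNReal.ofReal (r ^ 2)) + 4 := by
  classical
  have hρ' : 0 < 1 - ρ := by linarith
  set f : ℝ → ℝ≥0∞ := fun r =>
    (μH[1].restrict E) (coneA x (itv c (α * ℓ)) (ρ * r) r) / ENNReal.ofReal (r ^ 2) with hf
  set I := ∫⁻ r in Ioc (ρ ^ j) (ρ ^ l), f r with hI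
  set g : ℕ → ℝ≥0∞ := fun k => ∫⁻ r in Ioc (ρ ^ (k + 1)) (ρ ^ k), f r with hg
  have hIg : I = ∑ k ∈ Finset.Ico l j, g k := setLIntegral_Ioc_eq_sum_pow hρ0 hρ1 f hlj
  set B := badScales ρ E x c ℓ l j with hB
  set T := B.filter fun k => ediam E ≤ ENNReal.ofReal (η * ℓ * ρ ^ k) with hT
  set N := (Finset.Ico l j).filter fun k => k + 1 < j ∧ k + 1 ∈ B ∧
    ENNReal.ofReal (η * ℓ * ρ ^ (k + 1)) < ediam E with hN
  set a : ℝ := A⁻¹ * η * ℓ * (ρ ^ 2 * (1 - ρ) / 2) with ha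
  have ha0 : 0 < a := by positivity
  have hTcard : T.card ≤ 2 := by
    refine T.card_le_two_of_le_add_one fun k hk k' hk' => ?_
    rw [hT, Finset.mem_filter] at hk hk'
    refine le_add_one_of_bad_of_diam_le hρ0 hρ1 hη0 hη3
      (hk'.2.trans (ENNReal.ofReal_le_ofReal ?_)) (mem_badScales.1 hk.1).2.2
      (mem_badScales.1 hk'.1).2.2
    have : 0 < η * ρ ^ k' := by positivity
    nlinarith
  have hBsub : B ⊆ (({l, j} : Finset ℕ) ∪ T) ∪ N.image (· + 1) := by
    intro k hk
    have hk' := mem_badScales.1 hk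
    simp only [Finset.mem_union, Finset.mem_insert, Finset.mem_singleton, Finset.mem_image]
    by_cases h1 : k = l
    · exact Or.inl (Or.inl (Or.inl h1))
    by_cases h2 : k = j
    · exact Or.inl (Or.inl (Or.inr h2))
    by_cases h3 : ediam E ≤ ENNReal.ofReal (η * ℓ * ρ ^ k)
    · exact Or.inl (Or.inr (Finset.mem_filter.2 ⟨hk, h3⟩))
    · obtain ⟨m, rfl⟩ : ∃ m, k = m + 1 := ⟨k - 1, by omega⟩
      refine Or.inr ⟨m, Finset.mem_filter.2 ⟨Finset.mem_Ico.2 ?_, ?_, hk, not_le.1 h3⟩, rfl⟩ <;>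
        omega
  have hBcard : B.card ≤ N.card + 4 := by
    have h1 := Finset.card_le_card hBsub
    have h2 := Finset.card_union_le (({l, j} : Finset ℕ) ∪ T) (N.image (· + 1))
    have h3 := Finset.card_union_le ({l, j} : Finset ℕ) T
    have h4 : ({l, j} : Finset ℕ).card ≤ 2 := Finset.card_le_two
    have h5 : (N.image (· + 1)).card ≤ N.card := Finset.card_image_le
    omega
  have hNe : (N.card : ℝ≥0∞) * ENNReal.ofReal a ≤ 2 * I := by
    calc (N.card : ℝ≥0∞) * ENNReal.ofReal a = ∑ _k ∈ N, ENNReal.ofReal a := by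
          rw [Finset.sum_const, nsmul_eq_mul]
      _ ≤ ∑ k ∈ N, (g (k + 1) + g k) := by
          refine Finset.sum_le_sum fun k hk => ?_
          obtain ⟨-, -, hkB, hkd⟩ := Finset.mem_filter.1 hk
          refine (le_setLIntegral_of_bad hρ0 hρ1 hη0 hη1 hη2 hη3 hA hE hℓ0 hℓ1 hkd
            (mem_badScales.1 hkB).2.2).trans ?_
          rw [← Ioc_union_Ioc_eq_Ioc (b := ρ ^ (k + 1))
            (pow_le_pow_of_le_one hρ0.le hρ1.le (by omega))
            (pow_le_pow_of_le_one hρ0.le hρ1.le (by omega))]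
          exact lintegral_union_le _ _ _
      _ = ∑ k ∈ N, g (k + 1) + ∑ k ∈ N, g k := Finset.sum_add_distrib
      _ ≤ I + I := by
          rw [hIg]
          refine add_le_add ?_ (Finset.sum_le_sum_of_subset (Finset.filter_subset _ _))
          rw [← Finset.sum_image (f := g) (g := fun k => k + 1) (fun _ _ _ _ h => by simpa using h)]
          refine Finset.sum_le_sum_of_subset fun k hk => ?_
          obtain ⟨m, hm, rfl⟩ := Finset.mem_image.1 hk
          obtain ⟨hm1, hm2, -⟩ := Finset.mem_filter.1 hm
          rw [Finset.mem_Ico] at hm1 ⊢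
          omega
      _ = 2 * I := (two_mul I).symm
  have hN' : (N.card : ℝ≥0∞) ≤ ENNReal.ofReal (4 / (η * ρ ^ 2 * (1 - ρ)) * A * ℓ⁻¹) * I := by
    have hc : ENNReal.ofReal (4 / (η * ρ ^ 2 * (1 - ρ)) * A * ℓ⁻¹)
        = 2 / ENNReal.ofReal a := by
      rw [← ENNReal.ofReal_ofNat 2, ← ENNReal.ofReal_div_of_pos ha0, ha]
      congr 1
      field_simp
      norm_num
    rw [hc, div_eq_mul_inv, mul_right_comm, ← div_eq_mul_inv]
    exact (ENNReal.le_div_iff_mul_le (Or.inl (by simpa using ha0))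
      (Or.inl ENNReal.ofReal_ne_top)).2 hNe
  rw [badCard_eq_card_badScales]
  calc (B.card : ℝ≥0∞) ≤ ((N.card + 4 : ℕ) : ℝ≥0∞) := by exact_mod_cast hBcard
    _ = N.card + 4 := by push_cast; rfl
    _ ≤ _ := by gcongr

/-- The part of `E` in a cone of aperture `ℓ` projects into a short interval. -/
lemma measure_coneA_le {α c ℓ M r R d θ : ℝ} {x y : R2} (μ : Measure R2) (hα : 1 < α)
    (hℓ : 0 < ℓ) (hR : 0 < R) (hdR : d ≤ R) (hy : dmet c ℓ x y ≤ α * d)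
    (hθ : θ ∈ itv c (α * ℓ)) (hM : projMaxPerp μ θ y ≤ ENNReal.ofReal M) :
    μ (coneA x (itv c ℓ) r R) ≤
      ENNReal.ofReal (2 * ((Real.pi * (α + 1) + α + Real.pi * α ^ 2 + 1) * ℓ * R) * M) := by
  have hα0 : 0 < α := by linarith
  refine le_trans (measure_mono fun z hz => ?_) (measure_preimage_Ioo_le_of_maximalFn_le
    (continuous_projPerp θ).measurable (by positivity) hM)
  obtain ⟨φ, hφ, t, rfl, ht, -⟩ := mem_coneA_iff.1 hz
  rw [itv, mem_Icc] at hφ hθ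
  have h1 : |φ - θ| ≤ (α + 1) * ℓ / 2 := by
    rw [abs_le]; constructor <;> linarith
  have h2 : |θ - c| ≤ α * ℓ / 2 := by
    rw [abs_le]; constructor <;> linarith
  have h3 : |projPerp θ (x + t • dir φ) - projPerp θ x| ≤ R * (2 * Real.pi * ((α + 1) * ℓ / 2)) :=
    (abs_projPerp_add_smul_dir_sub_le x t φ θ).trans (by gcongr)
  have hd0 : 0 ≤ α * d := (Real.sqrt_nonneg _).trans hy
  have h4 : |projPerp θ x - projPerp θ y|
      ≤ α * R * ℓ + α * R * (2 * Real.pi * (α * ℓ / 2)) :=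
    (abs_projPerp_sub_le_of_dmet_le hℓ hy).trans (by gcongr)
  have h5 : 0 < ℓ * R := by positivity
  rw [abs_le] at h3 h4
  rw [mem_preimage, mem_Ioo]
  constructor <;> nlinarith

lemma energy_le_badCard {α ρ M c ℓ θ : ℝ} {E : Set R2} {x y : R2} {l j : ℕ} (hα : 1 < α)
    (hρ0 : 0 < ρ) (hρ1 : ρ < 1) (hℓ : 0 < ℓ) (hlj : l ≤ j) (hE : MeasurableSet E)
    (hy : dmet c ℓ x y ≤ α * ρ ^ j) (hθ : θ ∈ itv c (α * ℓ))
    (hM : projMaxPerp (μH[1].restrict E) θ y ≤ ENNReal.ofReal M) :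
    (∫⁻ r in Ioc (ρ ^ j) (ρ ^ l),
        (μH[1].restrict E) (coneA x (itv c ℓ) (ρ * r) r) / ENNReal.ofReal (r ^ 2)) ≤
      ENNReal.ofReal
        (4 * (Real.pi * (α + 1) + α + Real.pi * α ^ 2 + 1) * (1 - ρ) / ρ ^ 2 * M * ℓ) *
        (badCard ρ E x c ℓ l j : ℝ≥0∞) := by
  classical
  have hα0 : 0 < α := by linarith
  have hρ' : 0 < 1 - ρ := by linarith
  set D := Real.pi * (α + 1) + α + Real.pi * α ^ 2 + 1 with hD
  have hD0 : 0 < D := by positivity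
  set B := badScales ρ E x c ℓ l j with hB
  set K := ENNReal.ofReal (2 * D * (1 - ρ) / ρ ^ 2 * M * ℓ) with hK
  have hterm : ∀ k ∈ Finset.Ico l j, ∫⁻ r in Ioc (ρ ^ (k + 1)) (ρ ^ k),
      (μH[1].restrict E) (coneA x (itv c ℓ) (ρ * r) r) / ENNReal.ofReal (r ^ 2) ≤
        (if k ∈ B then K else 0) + (if k + 1 ∈ B then K else 0) := by
    intro k hk
    rw [Finset.mem_Ico] at hk
    set P := ρ ^ k with hP
    have hP0 : 0 < P := pow_pos hρ0 k
    have e1 : ρ ^ (k + 1) = ρ * P := by rw [hP]; ring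
    have e2 : ρ ^ (k + 1 + 1) = ρ ^ 2 * P := by rw [hP]; ring
    by_cases hb : k ∈ B ∨ k + 1 ∈ B
    · have hKle : K ≤ (if k ∈ B then K else 0) + (if k + 1 ∈ B then K else 0) := by
        rcases hb with h | h <;> simp [h]
      refine le_trans ?_ hKle
      rw [e1]
      have hup : ∀ r ∈ Ioc (ρ * P) P,
          (μH[1].restrict E) (coneA x (itv c ℓ) (ρ * r) r) / ENNReal.ofReal (r ^ 2) ≤
            ENNReal.ofReal (2 * (D * ℓ * P) * M / (ρ * P) ^ 2) := by
        rintro r ⟨hr1, hr2⟩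
        rw [ENNReal.ofReal_div_of_pos (by positivity)]
        refine ENNReal.div_le_div ?_ (ENNReal.ofReal_le_ofReal
          (pow_le_pow_left₀ (by positivity) hr1.le 2))
        refine le_trans (measure_mono fun z hz => ?_) (measure_coneA_le (r := ρ * r) _ hα hℓ hP0
          (pow_le_pow_of_le_one hρ0.le hρ1.le hk.2.le) hy hθ hM)
        obtain ⟨φ, hφ, t, h, h1, h2⟩ := mem_coneA_iff.1 hz
        exact mem_coneA_iff.2 ⟨φ, hφ, t, h, h1.trans_le hr2, h2⟩
      refine (setLIntegral_mono' measurableSet_Ioc hup).trans_eq ?_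
      rw [setLIntegral_const, Real.volume_Ioc, mul_comm,
        ← ENNReal.ofReal_mul (by nlinarith), hK]
      congr 1
      field_simp
    · push Not at hb
      refine le_trans (le_of_eq ?_) zero_le
      rw [e1, setLIntegral_congr_fun (g := fun _ => 0) measurableSet_Ioc, lintegral_zero]
      rintro r ⟨hr1, hr2⟩
      have hempty : coneA x (itv c ℓ) (ρ * r) r ∩ E = ∅ := by
        rw [Set.eq_empty_iff_forall_notMem]
        rintro z ⟨hz, hzE⟩
        obtain ⟨φ, hφ, t, h, h1, h2⟩ := mem_coneA_iff.1 hz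
        rcases le_or_gt (ρ * P) |t| with h3 | h3
        · exact hb.1 (mem_badScales.2 ⟨hk.1, hk.2.le, z,
            mem_coneA_iff.2 ⟨φ, hφ, t, h, h1.trans_le hr2, by rwa [e1]⟩, hzE⟩)
        · refine hb.2 (mem_badScales.2 ⟨by omega, hk.2, z,
            mem_coneA_iff.2 ⟨φ, hφ, t, h, by rwa [e1], ?_⟩, hzE⟩)
          rw [e2]
          nlinarith
      simp [Measure.restrict_apply' hE, hempty]
  have hsum1 : ∑ k ∈ Finset.Ico l j, (if k ∈ B then K else 0) ≤ B.card * K := by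
    rw [← Finset.sum_filter, Finset.sum_const, nsmul_eq_mul]
    gcongr
    exact fun k hk => (Finset.mem_filter.1 hk).2
  have hsum2 : ∑ k ∈ Finset.Ico l j, (if k + 1 ∈ B then K else 0) ≤ B.card * K := by
    rw [← Finset.sum_filter, Finset.sum_const, nsmul_eq_mul]
    refine mul_le_mul' (Nat.cast_le.2 ?_) le_rfl
    exact Finset.card_le_card_of_injOn (· + 1) (fun k hk => (Finset.mem_filter.1 hk).2)
      (fun _ _ _ _ h => by simpa using h)
  rw [setLIntegral_Ioc_eq_sum_pow hρ0 hρ1 _ hlj, badCard_eq_card_badScales]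
  calc _ ≤ ∑ k ∈ Finset.Ico l j, ((if k ∈ B then K else 0) + (if k + 1 ∈ B then K else 0)) :=
        Finset.sum_le_sum hterm
    _ ≤ B.card * K + B.card * K := by
        rw [Finset.sum_add_distrib]
        exact add_le_add hsum1 hsum2
    _ = 2 * K * B.card := by ring
    _ = _ := by
        rw [hK, ← ENNReal.ofReal_ofNat 2, ← ENNReal.ofReal_mul (by norm_num)]
        congr 2
        ring

/-- comparing the number of bad scales with conical energies. -/
theorem statement14 (α ρ : ℝ) (hα : 1 < α) (hρ0 : 0 < ρ) (hρ1 : ρ < 1) :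
    ∃ C₁ C₂ : ℝ, 0 < C₁ ∧ 0 < C₂ ∧
      ∀ (A M : ℝ) (E : Set R2) (x : R2) (c ℓJ : ℝ) (l j : ℕ),
        1 ≤ A → AhlforsRegular A E → 0 < ℓJ → ℓJ ≤ 1 → l ≤ j →
        ((badCard ρ E x c ℓJ l j : ℝ≥0∞) ≤
          ENNReal.ofReal (C₁ * A * ℓJ⁻¹) *
            (∫⁻ r in Set.Ioc (ρ^j) (ρ^l),
              (μH[1].restrict E) (coneA x (itv c (α * ℓJ)) (ρ*r) r) / ENNReal.ofReal (r^2)) +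
          ENNReal.ofReal C₁) ∧
        ((∃ y : R2, dmet c ℓJ x y ≤ α * ρ^j ∧
            ∃ θ ∈ itv c (α * ℓJ),
              projMaxPerp (μH[1].restrict E) θ y ≤ ENNReal.ofReal M) →
          (∫⁻ r in Set.Ioc (ρ^j) (ρ^l),
              (μH[1].restrict E) (coneA x (itv c ℓJ) (ρ*r) r) / ENNReal.ofReal (r^2)) ≤
            ENNReal.ofReal (C₂ * M * ℓJ) * (badCard ρ E x c ℓJ l j : ℝ≥0∞)) := by
  have hα0 : 0 < α := by linarith
  have hα1 : 0 < α - 1 := by linarith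
  have hρ' : 0 < 1 - ρ := by linarith
  set η := min (ρ * (α - 1) / 2) (min (ρ / 2) (ρ * (1 - ρ) / 4)) with hη
  have hη0 : 0 < η := by
    refine lt_min ?_ (lt_min ?_ ?_) <;> positivity
  have hη1 : η ≤ ρ * (α - 1) / 2 := min_le_left _ _
  have hη2 : η ≤ ρ / 2 := (min_le_right _ _).trans (min_le_left _ _)
  have hη3 : η ≤ ρ * (1 - ρ) / 4 := (min_le_right _ _).trans (min_le_right _ _)
  have hC : 0 < 4 / (η * ρ ^ 2 * (1 - ρ)) := by positivity
  refine ⟨4 / (η * ρ ^ 2 * (1 - ρ)) + 4,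
    4 * (Real.pi * (α + 1) + α + Real.pi * α ^ 2 + 1) * (1 - ρ) / ρ ^ 2,
    by positivity, by positivity, ?_⟩
  intro A M E x c ℓJ l j hA hE hℓ0 hℓ1 hlj
  refine ⟨?_, ?_⟩
  · refine (badCard_le_energy hρ0 hρ1 hη0 hη1 hη2 hη3 hA hE hℓ0 hℓ1 hlj).trans ?_
    refine add_le_add ?_ ?_
    · gcongr
      linarith
    · rw [← ENNReal.ofReal_ofNat 4]
      exact ENNReal.ofReal_le_ofReal (by linarith)
  · rintro ⟨y, hy, θ, hθ, hM⟩
    exact energy_le_badCard hα hρ0 hρ1 hℓ0 hlj hE.1.measurableSet hy hθ hM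

end
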